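/- arXiv:0906.2240 — 6 statements merged into one kernel-verified Lean document; each statement's English description precedes it below -/
import Mathlib

section
/- Let K be a compact metric space, g : K → K a continuous map, and φ : K → ℝ a continuous function. Suppose that for every g-invariant Borel probability measure μ on K one has ∫ φ dμ < λ. Then there exists N ∈ ℕ such that for every n ≥ N and every x ∈ K, (1/n) · ∑_{i=0}^{n-1} φ(g^i(x)) < λ. -/
open MeasureTheory Filter

/-- Empirical measure along an orbit. -/
noncomputable def empM {K : Type*} [MeasurableSpace K] (g : K → K) (n : ℕ) (x : K) : Measure K :=
  (n : ENNReal)⁻¹ • ∑ i ∈ Finset.range n, Measure.dirac (g^[i] x)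

lemma empM_prob {K : Type*} [MeasurableSpace K] (g : K → K) (n : ℕ) (hn : n ≠ 0) (x : K) :
    IsProbabilityMeasure (empM g n x) := by
  constructor
  simp only [empM, Measure.smul_apply, Measure.finsetSum_apply, measure_univ, Finset.sum_const,
    Finset.card_range, smul_eq_mul, nsmul_eq_mul, mul_one]
  exact ENNReal.inv_mul_cancel (by exact_mod_cast hn) (ENNReal.natCast_ne_top n)

lemma empM_integral {K : Type*} [MetricSpace K] [CompactSpace K] [MeasurableSpace K] [BorelSpace K]
    (g : K → K) (n : ℕ) (x : K) (f : K → ℝ) (hf : Continuous f) :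
    ∫ y, f y ∂(empM g n x) = (1 / (n : ℝ)) * ∑ i ∈ Finset.range n, f (g^[i] x) := by
  rw [empM, integral_smul_measure, integral_finsetSum_measure]
  · simp
  · intro i _
    exact (BoundedContinuousFunction.mkOfCompact ⟨f, hf⟩).integrable _

theorem birkhoff_average_lt_of_integral_lt
    {K : Type*} [MetricSpace K] [CompactSpace K] [MeasurableSpace K] [BorelSpace K]
    (g : K → K) (hg : Continuous g) (φ : K → ℝ) (hφ : Continuous φ) (lam : ℝ)
    (h : ∀ μ : Measure K, IsProbabilityMeasure μ → μ.map g = μ → (∫ x, φ x ∂μ) < lam) :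
    ∃ N : ℕ, ∀ n ≥ N, ∀ x : K,
      (1 / (n : ℝ)) * ∑ i ∈ Finset.range n, φ (g^[i] x) < lam := by
  by_contra! hc
  choose n hn x hx using fun k : ℕ => hc (k + 1)
  have hn0 : ∀ k, n k ≠ 0 := fun k => by have := hn k; omega
  let P : ℕ → ProbabilityMeasure K := fun k => ⟨empM g (n k) (x k), empM_prob g _ (hn0 k) _⟩
  let U : Ultrafilter ℕ := Ultrafilter.of atTop
  have hU : (U : Filter ℕ) ≤ atTop := Ultrafilter.of_le _
  obtain ⟨μ, -, hμ⟩ := isCompact_univ.ultrafilter_le_nhds (U.map P) (by simp)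
  have hlim : Tendsto P U (nhds μ) := hμ
  have key : ∀ f : K → ℝ, Continuous f →
      Tendsto (fun k => (1 / (n k : ℝ)) * ∑ i ∈ Finset.range (n k), f (g^[i] (x k))) U
        (nhds (∫ y, f y ∂(μ : Measure K))) := by
    intro f hf
    have := (ProbabilityMeasure.tendsto_iff_forall_integral_tendsto.1 hlim)
      (BoundedContinuousFunction.mkOfCompact ⟨f, hf⟩)
    refine this.congr fun k => ?_
    exact empM_integral g (n k) (x k) f hf
  have hnt : Tendsto (fun k => (n k : ℝ)) atTop atTop :=
    tendsto_natCast_atTop_atTop.comp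
      (tendsto_atTop_mono (fun k => (Nat.le_succ k).trans (hn k)) tendsto_id)
  have hinv : (μ : Measure K).map g = μ := by
    have : IsProbabilityMeasure ((μ : Measure K).map g) :=
      Measure.isProbabilityMeasure_map hg.aemeasurable
    refine ext_of_forall_integral_eq_of_IsFiniteMeasure fun f => ?_
    rw [integral_map hg.aemeasurable f.continuous.aestronglyMeasurable]
    have h1 := (key (fun y => f (g y)) (f.continuous.comp hg)).sub (key f f.continuous)
    have h2 : Tendsto (fun k => (1 / (n k : ℝ)) * ∑ i ∈ Finset.range (n k), f (g (g^[i] (x k)))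
        - (1 / (n k : ℝ)) * ∑ i ∈ Finset.range (n k), f (g^[i] (x k))) atTop (nhds 0) := by
      refine squeeze_zero_norm (a := fun k => 2 * ‖f‖ / (n k : ℝ)) (fun k => ?_)
        (hnt.const_div_atTop _)
      rw [← mul_sub, ← Finset.sum_sub_distrib]
      have := Finset.sum_range_sub (fun i => f (g^[i] (x k))) (n k)
      simp only [Function.iterate_succ_apply'] at this
      rw [this, norm_mul, norm_div, norm_one, Real.norm_natCast, div_mul_eq_mul_div, one_mul]
      gcongr
      rw [← dist_eq_norm]
      exact f.dist_le_two_norm _ _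
    exact sub_eq_zero.1 (tendsto_nhds_unique h1 (h2.mono_left hU))
  exact absurd (h μ inferInstance hinv) (not_lt.2 (ge_of_tendsto' (key φ hφ) hx))
end

section
/- Let K be a compact metric space, g : K → K a continuous map, and (φ_n)_{n≥1} a sequence of continuous functions φ_n : K → ℝ that is g-subadditive, i.e. φ_{n₁+n₂}(x) ≤ φ_{n₁}(x) + φ_{n₂}(g^{n₁}(x)) for all n₁, n₂ ≥ 1 and all x ∈ K. Suppose that ∫ φ_1 dμ < λ for every g-invariant Borel probability measure μ on K. Then there exists N ∈ ℕ such that for all n ≥ N and all x ∈ K, φ_n(x) ≤ n · λ. -/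
open MeasureTheory Filter

/-- empirical measure -/
noncomputable def empMeas {K : Type*} [MeasurableSpace K] (g : K → K) (n : ℕ) (x : K) :
    Measure K :=
  ((n : ENNReal)⁻¹) • ∑ k ∈ Finset.range n, Measure.dirac (g^[k] x)

lemma empMeas_prob {K : Type*} [MeasurableSpace K] (g : K → K) (n : ℕ) (hn : n ≠ 0) (x : K) :
    IsProbabilityMeasure (empMeas g n x) := by
  constructor
  simp only [empMeas, Measure.smul_apply, Measure.finset_sum_apply, measure_univ, smul_eq_mul,
    Finset.sum_const, Finset.card_range, nsmul_eq_mul, mul_one]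
  exact ENNReal.inv_mul_cancel (by exact_mod_cast hn) (ENNReal.natCast_ne_top n)

lemma empMeas_integral {K : Type*} [MetricSpace K] [MeasurableSpace K] [BorelSpace K]
    (g : K → K) (n : ℕ) (x : K) (f : BoundedContinuousFunction K ℝ) :
    ∫ y, f y ∂(empMeas g n x) = (n : ℝ)⁻¹ * ∑ k ∈ Finset.range n, f (g^[k] x) := by
  rw [empMeas, integral_smul_measure, integral_finset_sum_measure]
  · simp
  · intro i _
    exact f.integrable _

/-- Proposition 3.7: if `(φ_n)` is a `g`-subadditive sequence of continuous functions on a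
compact metric space and `∫ φ₁ dμ < λ` for every `g`-invariant Borel probability measure `μ`,
then eventually `φ_n(x) ≤ n λ` uniformly on `K`. -/
theorem subadditive_le_of_integral_lt
    {K : Type*} [MetricSpace K] [CompactSpace K] [MeasurableSpace K] [BorelSpace K]
    (g : K → K) (hg : Continuous g) (φ : ℕ → K → ℝ)
    (hφcont : ∀ n, 1 ≤ n → Continuous (φ n))
    (hsub : ∀ n₁, 1 ≤ n₁ → ∀ n₂, 1 ≤ n₂ → ∀ x : K,
      φ (n₁ + n₂) x ≤ φ n₁ x + φ n₂ (g^[n₁] x))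
    (lam : ℝ)
    (h : ∀ μ : Measure K, IsProbabilityMeasure μ → μ.map g = μ → (∫ x, φ 1 x ∂μ) < lam) :
    ∃ N : ℕ, ∀ n ≥ N, ∀ x : K, φ n x ≤ (n : ℝ) * lam := by
  have hS : ∀ n : ℕ, ∀ x, φ (n + 1) x ≤ ∑ k ∈ Finset.range (n + 1), φ 1 (g^[k] x) := by
    intro n x
    induction n with
    | zero => simp
    | succ n ih =>
      rw [Finset.sum_range_succ]
      have := hsub (n + 1) (by omega) 1 le_rfl x
      linarith
  by_contra! hcon
  choose u hu x hx using fun N : ℕ => hcon (N + 1)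
  have hu0 : ∀ N, u N ≠ 0 := fun N => by have := hu N; omega
  have hupos : ∀ N, (0 : ℝ) < u N := fun N => by exact_mod_cast Nat.pos_of_ne_zero (hu0 N)
  let ν : ℕ → ProbabilityMeasure K := fun N => ⟨empMeas g (u N) (x N), empMeas_prob g _ (hu0 N) _⟩
  let U : Ultrafilter ℕ := hyperfilter ℕ
  have hU : (U : Filter ℕ) ≤ atTop := by
    rw [← Nat.cofinite_eq_atTop]; exact hyperfilter_le_cofinite
  obtain ⟨μ, -, hμ⟩ := isCompact_univ.ultrafilter_le_nhds (U.map ν) (by simp)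
  have hμ' : Tendsto ν U (nhds μ) := hμ
  rw [ProbabilityMeasure.tendsto_iff_forall_integral_tendsto] at hμ'
  have key : ∀ f : BoundedContinuousFunction K ℝ,
      Tendsto (fun N => (u N : ℝ)⁻¹ * ∑ k ∈ Finset.range (u N), f (g^[k] (x N))) U
        (nhds (∫ y, f y ∂(μ : Measure K))) := by
    intro f
    refine (hμ' f).congr fun N => ?_
    exact empMeas_integral g (u N) (x N) f
  have hinv : (μ : Measure K).map g = μ := by
    have : IsProbabilityMeasure ((μ : Measure K).map g) :=
      Measure.isProbabilityMeasure_map hg.measurable.aemeasurable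
    apply ext_of_forall_integral_eq_of_IsFiniteMeasure
    intro f
    rw [integral_map hg.measurable.aemeasurable f.continuous.aestronglyMeasurable]
    have h1 := key f
    have h2 := key (f.compContinuous ⟨g, hg⟩)
    have h3 := h2.sub h1
    have h4 : Tendsto (fun N : ℕ => 2 * ‖f‖ * (1 / ((N : ℝ) + 1))) U (nhds (2 * ‖f‖ * 0)) :=
      (tendsto_one_div_add_atTop_nhds_zero_nat.const_mul _).mono_left hU
    rw [mul_zero] at h4
    have h5 := squeeze_zero_norm (fun N => ?_) h4 |> tendsto_nhds_unique h3
    · simpa [sub_eq_zero] using h5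
    · rw [← mul_sub, ← Finset.sum_sub_distrib]
      have : ∀ k, (f.compContinuous ⟨g, hg⟩) (g^[k] (x N)) = f (g^[k+1] (x N)) := by
        intro k; rw [Function.iterate_succ_apply']; rfl
      simp only [this]
      rw [Finset.sum_range_sub (fun k => f (g^[k] (x N))), norm_mul, mul_comm]
      gcongr
      · exact (norm_sub_le _ _).trans (by
          linarith [f.norm_coe_le_norm (g^[u N] (x N)), f.norm_coe_le_norm (g^[0] (x N))])
      · rw [norm_inv, one_div, Real.norm_of_nonneg (hupos N).le]
        apply inv_anti₀ (by positivity)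
        exact_mod_cast hu N
  have hlt := h μ inferInstance hinv
  have hge := ge_of_tendsto (b := lam) (key (BoundedContinuousFunction.mkOfCompact
    ⟨φ 1, hφcont 1 le_rfl⟩)) (Eventually.of_forall fun N => by
      have h1 := hx N
      obtain ⟨m, hm⟩ := Nat.exists_eq_succ_of_ne_zero (hu0 N)
      have h2 := hS m (x N)
      rw [← Nat.succ_eq_add_one, ← hm] at h2
      rw [inv_mul_eq_div, le_div_iff₀ (hupos N), mul_comm]
      exact (h1.trans_le h2).le)
  exact absurd hlt (not_lt.mpr hge)
end

section
/- Let K be a compact metric space, g : K → K a continuous map, E a nontrivial normed real vector space, and A : K → (E ≃L E) a map assigning to each x ∈ K a continuous linear isomorphism A(x) of E, such that both x ↦ A(x) and x ↦ A(x)⁻¹ are continuous (as maps into the continuous linear endomorphisms of E with the operator norm). Write A_n(x) := A(g^{n-1}(x)) ∘ ⋯ ∘ A(g(x)) ∘ A(x). Suppose there exists λ < 0 such that ∫ log ‖A(x)⁻¹‖ dμ(x) < λ for every g-invariant Borel probability measure μ on K. Then there is a constant C > 0 such that ‖(A_n(x))⁻¹‖ ≤ C · e^{λ n} for all n ≥ 1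 and all x ∈ K; in particular ‖A_n(x) v‖ ≥ C⁻¹ · e^{-λ n} · ‖v‖ for all v ∈ E. -/
open MeasureTheory Filter

/-- The cocycle `A_n(x) = A(g^{n-1}(x)) ∘ ⋯ ∘ A(g(x)) ∘ A(x)` of continuous linear
isomorphisms over the map `g`. -/
noncomputable def equivCocycle {K E : Type*} [NormedAddCommGroup E] [NormedSpace ℝ E]
    (g : K → K) (A : K → (E ≃L[ℝ] E)) : ℕ → K → (E ≃L[ℝ] E)
  | 0, _ => ContinuousLinearEquiv.refl ℝ E
  | n + 1, x => (equivCocycle g A n x).trans (A (g^[n] x))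

theorem exists_invariant_limit {K : Type*} [MetricSpace K] [CompactSpace K] [MeasurableSpace K]
    [BorelSpace K] (g : K → K) (hg : Continuous g) (n : ℕ → ℕ) (hn : ∀ k, k + 1 ≤ n k)
    (x : ℕ → K) (φ : BoundedContinuousFunction K ℝ) (lam : ℝ)
    (hφ : ∀ k, lam * n k ≤ birkhoffSum g φ (n k) (x k)) :
    ∃ μ : Measure K, IsProbabilityMeasure μ ∧ μ.map g = μ ∧ lam ≤ ∫ y, φ y ∂μ := by
  have hn0 : ∀ k, (0 : ℝ) < n k := fun k => by
    have := hn k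
    exact_mod_cast (by omega : 0 < n k)
  let m : ℕ → Measure K := fun k =>
    ENNReal.ofReal ((n k : ℝ)⁻¹) • ∑ i ∈ Finset.range (n k), Measure.dirac (g^[i] (x k))
  have hm : ∀ k, IsProbabilityMeasure (m k) := fun k => by
    constructor
    simp only [m, Measure.smul_apply, Measure.finset_sum_apply, measure_univ, smul_eq_mul,
      Finset.sum_const, Finset.card_range, nsmul_eq_mul, mul_one]
    rw [ENNReal.ofReal_inv_of_pos (hn0 k), ENNReal.ofReal_natCast]
    have := hn k
    exact ENNReal.inv_mul_cancel (by simp; omega) (by simp)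
  have hint : ∀ k (f : BoundedContinuousFunction K ℝ),
      ∫ y, f y ∂(m k) = (n k : ℝ)⁻¹ * birkhoffSum g f (n k) (x k) := fun k f => by
    simp only [m]
    rw [integral_smul_measure, integral_finset_sum_measure]
    · rw [ENNReal.toReal_ofReal (by have := hn0 k; positivity)]
      simp [birkhoffSum, integral_dirac]
    · intro i _
      exact f.integrable _
  let P : ℕ → ProbabilityMeasure K := fun k => ⟨m k, hm k⟩
  let U : Ultrafilter ℕ := Ultrafilter.of atTop
  have hU : (U : Filter ℕ) ≤ atTop := Ultrafilter.of_le _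
  obtain ⟨μ, -, hμ⟩ := isCompact_univ.ultrafilter_le_nhds (U.map P) (by simp)
  have hμ' : Tendsto P U (nhds μ) := hμ
  have hlim := ProbabilityMeasure.tendsto_iff_forall_integral_tendsto.1 hμ'
  have hlim' : ∀ f : BoundedContinuousFunction K ℝ,
      Tendsto (fun k => (n k : ℝ)⁻¹ * birkhoffSum g f (n k) (x k)) U
        (nhds (∫ y, f y ∂(μ : Measure K))) := fun f => by
    refine (hlim f).congr fun k => ?_
    exact hint k f
  refine ⟨μ, inferInstance, ?_, ?_⟩
  · have : IsProbabilityMeasure ((μ : Measure K).map g) :=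
      Measure.isProbabilityMeasure_map hg.aemeasurable
    refine ext_of_forall_integral_eq_of_IsFiniteMeasure fun f => ?_
    rw [integral_map hg.aemeasurable f.continuous.aestronglyMeasurable]
    let f' : BoundedContinuousFunction K ℝ := f.compContinuous ⟨g, hg⟩
    have h1 := (hlim' f').sub (hlim' f)
    have h2 : Tendsto (fun k => (n k : ℝ)⁻¹ * birkhoffSum g f' (n k) (x k) -
        (n k : ℝ)⁻¹ * birkhoffSum g f (n k) (x k)) atTop (nhds 0) := by
      refine squeeze_zero_norm (a := fun k : ℕ => (2 * ‖f‖) * (1 / ((k : ℝ) + 1))) (fun k => ?_) ?_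
      · have e : birkhoffSum g f' (n k) (x k) = birkhoffSum g f (n k) (g (x k)) := by
          simp only [birkhoffSum]
          refine Finset.sum_congr rfl fun i _ => ?_
          change f (g (g^[i] (x k))) = _
          rw [← Function.iterate_succ_apply' g, Function.iterate_succ_apply]
        rw [e, ← mul_sub, birkhoffSum_apply_sub_birkhoffSum, norm_mul, mul_comm]
        have h3 : ‖f (g^[n k] (x k)) - f (x k)‖ ≤ 2 * ‖f‖ := by
          have := norm_sub_le (f (g^[n k] (x k))) (f (x k))
          have := f.norm_coe_le_norm (g^[n k] (x k))
          have := f.norm_coe_le_norm (x k)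
          linarith
        have h4 : ‖(n k : ℝ)⁻¹‖ ≤ 1 / ((k : ℝ) + 1) := by
          rw [norm_inv, Real.norm_of_nonneg (hn0 k).le, one_div]
          refine inv_anti₀ (by positivity) ?_
          exact_mod_cast hn k
        exact mul_le_mul h3 h4 (norm_nonneg _) (by positivity)
      · simpa using tendsto_one_div_add_atTop_nhds_zero_nat.const_mul (2 * ‖f‖)
    have h3 := tendsto_nhds_unique h1 (h2.mono_left hU)
    have h4 : ∫ y, f' y ∂(μ : Measure K) = ∫ y, f (g y) ∂(μ : Measure K) := rfl
    linarith
  · refine ge_of_tendsto (hlim' φ) (Eventually.of_forall fun k => ?_)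
    rw [inv_mul_eq_div, le_div_iff₀ (hn0 k)]
    exact hφ k

theorem symm_equivCocycle_norm_le {K E : Type*} [NormedAddCommGroup E] [NormedSpace ℝ E]
    [Nontrivial E] (g : K → K) (A : K → (E ≃L[ℝ] E)) (n : ℕ) (x : K) :
    ‖((equivCocycle g A n x).symm : E →L[ℝ] E)‖ ≤
      Real.exp (birkhoffSum g (fun x => Real.log ‖((A x).symm : E →L[ℝ] E)‖) n x) := by
  induction n with
  | zero =>
    simp only [birkhoffSum_zero, Real.exp_zero]
    exact ContinuousLinearMap.norm_id_le
  | succ n ih =>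
    rw [birkhoffSum_succ, Real.exp_add, Real.exp_log (ContinuousLinearEquiv.norm_symm_pos _)]
    refine le_trans ?_ (mul_le_mul_of_nonneg_right ih (norm_nonneg _))
    exact ContinuousLinearMap.opNorm_comp_le
      ((equivCocycle g A n x).symm : E →L[ℝ] E) ((A (g^[n] x)).symm : E →L[ℝ] E)

/-- If `∫ log ‖A(x)⁻¹‖ dμ < λ < 0` for every `g`-invariant Borel probability measure `μ` on
the compact metric space `K`, then the inverse cocycle contracts uniformly exponentially:
`‖(A_n(x))⁻¹‖ ≤ C e^{λ n}`, hence `‖A_n(x) v‖ ≥ C⁻¹ e^{-λ n} ‖v‖`. -/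
theorem cocycle_uniform_expansion_of_integral_lt
    {K : Type*} [MetricSpace K] [CompactSpace K] [MeasurableSpace K] [BorelSpace K]
    {E : Type*} [NormedAddCommGroup E] [NormedSpace ℝ E] [Nontrivial E]
    (g : K → K) (hg : Continuous g) (A : K → (E ≃L[ℝ] E))
    (hA : Continuous fun x => (A x : E →L[ℝ] E))
    (hA' : Continuous fun x => ((A x).symm : E →L[ℝ] E))
    (lam : ℝ) (hlam : lam < 0)
    (h : ∀ μ : Measure K, IsProbabilityMeasure μ → μ.map g = μ →
      (∫ x, Real.log ‖((A x).symm : E →L[ℝ] E)‖ ∂μ) < lam) :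
    ∃ C : ℝ, 0 < C ∧ ∀ n : ℕ, 1 ≤ n → ∀ x : K,
      ‖((equivCocycle g A n x).symm : E →L[ℝ] E)‖ ≤ C * Real.exp (lam * n) ∧
      ∀ v : E, C⁻¹ * Real.exp (-lam * n) * ‖v‖ ≤ ‖equivCocycle g A n x v‖ := by
  have hpos : ∀ x, 0 < ‖((A x).symm : E →L[ℝ] E)‖ := fun x =>
    ContinuousLinearEquiv.norm_symm_pos _
  let φ : BoundedContinuousFunction K ℝ := BoundedContinuousFunction.mkOfCompact
    ⟨fun x => Real.log ‖((A x).symm : E →L[ℝ] E)‖, hA'.norm.log fun x => (hpos x).ne'⟩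
  have key : ∃ N : ℕ, ∀ n, N + 1 ≤ n → ∀ x, birkhoffSum g φ n x ≤ lam * n := by
    by_contra! hcon
    choose n hn x hx using hcon
    obtain ⟨μ, hμ, hinv, hle⟩ := exists_invariant_limit g hg n hn x φ lam fun k => (hx k).le
    exact absurd (h μ hμ hinv) (not_lt.2 hle)
  obtain ⟨N, hN⟩ := key
  have hb : ∀ n x, birkhoffSum g φ n x ≤ n * ‖φ‖ := fun n x => by
    unfold birkhoffSum
    refine (Finset.sum_le_card_nsmul _ _ ‖φ‖ fun i _ => ?_).trans (by simp)
    exact (le_abs_self _).trans (φ.norm_coe_le_norm _)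
  have hmain : ∀ n x, birkhoffSum g φ n x ≤ N * (‖φ‖ - lam) + lam * n := fun n x => by
    have h0 := norm_nonneg φ
    have h1 : 0 ≤ ‖φ‖ - lam := by linarith
    rcases le_or_gt (N + 1) n with hn | hn
    · have := hN n hn x
      have : 0 ≤ N * (‖φ‖ - lam) := by positivity
      linarith
    · have h2 := hb n x
      have h3 : (n : ℝ) ≤ N := by exact_mod_cast (by omega : n ≤ N)
      nlinarith [mul_le_mul_of_nonneg_right h3 h1]
  have hfin : ∀ n x, ‖((equivCocycle g A n x).symm : E →L[ℝ] E)‖ ≤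
      Real.exp (N * (‖φ‖ - lam)) * Real.exp (lam * n) := fun n x => by
    rw [← Real.exp_add]
    exact (symm_equivCocycle_norm_le g A n x).trans (Real.exp_le_exp.2 (hmain n x))
  refine ⟨Real.exp (N * (‖φ‖ - lam)), Real.exp_pos _, fun n _ x => ⟨hfin n x, fun v => ?_⟩⟩
  have h1 : ‖v‖ ≤ Real.exp (N * (‖φ‖ - lam)) * Real.exp (lam * n) * ‖equivCocycle g A n x v‖ := by
    have h2 := ((equivCocycle g A n x).symm : E →L[ℝ] E).le_of_opNorm_le (hfin n x)
      (equivCocycle g A n x v)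
    simpa using h2
  rw [neg_mul, Real.exp_neg, ← mul_inv, inv_mul_le_iff₀ (by positivity)]
  exact h1
end

section
/- Let K be a compact metric space, g : K → K a continuous map, E a nontrivial normed real vector space, and A : K → (E →L E) a continuous map into the continuous linear endomorphisms of E with the operator norm. Write A_n(x) := A(g^{n-1}(x)) ∘ ⋯ ∘ A(g(x)) ∘ A(x). Suppose there exists λ < 0 such that ∫ log ‖A(x)‖ dμ(x) < λ for every g-invariant Borel probability measure μ on K. Then there is a constant C > 0 such that ‖A_n(x)‖ ≤ C · e^{λ n} for all n ≥ 1 and all x ∈ K. -/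
open MeasureTheory Filter

/-- The cocycle `A_n(x) = A(g^{n-1}(x)) ∘ ⋯ ∘ A(g(x)) ∘ A(x)` of continuous linear maps over
the map `g`. -/
noncomputable def mapCocycle {K E : Type*} [NormedAddCommGroup E] [NormedSpace ℝ E]
    (g : K → K) (A : K → (E →L[ℝ] E)) : ℕ → K → (E →L[ℝ] E)
  | 0, _ => ContinuousLinearMap.id ℝ E
  | n + 1, x => (A (g^[n] x)).comp (mapCocycle g A n x)

open scoped Topology BoundedContinuousFunction

lemma exists_empirical {K : Type*} [MetricSpace K] [CompactSpace K] [MeasurableSpace K]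
    [BorelSpace K] (g : K → K) (x : K) (N : ℕ) :
    ∃ μ : ProbabilityMeasure K, ∀ f : K → ℝ, Continuous f →
      ∫ y, f y ∂(μ : Measure K) = birkhoffAverage ℝ g f (N + 1) x := by
  let ν : Measure K := ((N + 1 : ℕ) : ENNReal)⁻¹ •
    ∑ k ∈ Finset.range (N + 1), Measure.dirac (g^[k] x)
  have hν : IsProbabilityMeasure ν := by
    constructor
    simp only [ν, Measure.smul_apply, Measure.finsetSum_apply, measure_univ, Finset.sum_const,
      Finset.card_range, smul_eq_mul, nsmul_eq_mul, mul_one]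
    exact ENNReal.inv_mul_cancel (by simp) (by simp)
  refine ⟨⟨ν, hν⟩, fun f hf => ?_⟩
  change ∫ y, f y ∂ν = _
  simp only [ν]
  rw [integral_smul_measure, integral_finsetSum_measure]
  · simp only [birkhoffAverage, birkhoffSum, integral_dirac, ENNReal.toReal_inv,
      ENNReal.toReal_natCast]
  · intro i _
    exact integrable_dirac (by simp)

lemma exists_limit {K : Type*} [MetricSpace K] [CompactSpace K] [MeasurableSpace K]
    [BorelSpace K] (g : K → K) (hg : Continuous g) (x : ℕ → K) :
    ∃ (U : Ultrafilter ℕ) (μ : Measure K), (U : Filter ℕ) ≤ atTop ∧ IsProbabilityMeasure μ ∧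
      μ.map g = μ ∧ ∀ f : K → ℝ, Continuous f →
      Tendsto (fun N => birkhoffAverage ℝ g f (N + 1) (x N)) U (𝓝 (∫ y, f y ∂μ)) := by
  choose m hm using fun N => exists_empirical g (x N) N
  let U : Ultrafilter ℕ := Ultrafilter.of atTop
  have hU : (U : Filter ℕ) ≤ atTop := Ultrafilter.of_le _
  obtain ⟨μ, -, hμ⟩ := isCompact_univ.ultrafilter_le_nhds (U.map m) (by simp)
  have hμ' : Tendsto m U (𝓝 μ) := hμ
  rw [ProbabilityMeasure.tendsto_iff_forall_integral_tendsto] at hμ'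
  have key : ∀ f : K → ℝ, Continuous f →
      Tendsto (fun N => birkhoffAverage ℝ g f (N + 1) (x N)) U
        (𝓝 (∫ y, f y ∂(μ : Measure K))) := by
    intro f hf
    have := hμ' (BoundedContinuousFunction.mkOfCompact ⟨f, hf⟩)
    simpa [hm _ f hf] using this
  refine ⟨U, μ, hU, inferInstance, ?_, key⟩
  have : IsProbabilityMeasure ((μ : Measure K).map g) :=
    Measure.isProbabilityMeasure_map hg.measurable.aemeasurable
  apply ext_of_forall_integral_eq_of_IsFiniteMeasure
  intro f
  rw [integral_map hg.measurable.aemeasurable f.continuous.aestronglyMeasurable]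
  have h1 := key f f.continuous
  have h2 := key (fun y => f (g y)) (f.continuous.comp hg)
  have h3 : Tendsto (fun N : ℕ => birkhoffAverage ℝ g (fun y => f (g y)) (N + 1) (x N)
      - birkhoffAverage ℝ g f (N + 1) (x N)) U (𝓝 0) := by
    refine Tendsto.mono_left ?_ hU
    have h4 : Tendsto (fun N : ℕ => (2 * ‖f‖) * (1 / ((N : ℝ) + 1))) atTop (𝓝 0) := by
      simpa using tendsto_one_div_add_atTop_nhds_zero_nat.const_mul (2 * ‖f‖)
    refine squeeze_zero_norm (fun N => ?_) h4
    have e : birkhoffAverage ℝ g (fun y => f (g y)) (N + 1) (x N)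
        = birkhoffAverage ℝ g f (N + 1) (g (x N)) := by
      simp only [birkhoffAverage, birkhoffSum, ← Function.iterate_succ_apply,
        ← Function.iterate_succ_apply' g]
    rw [e, birkhoffAverage_apply_sub_birkhoffAverage, norm_smul]
    have h5 : ‖f (g^[N + 1] (x N)) - f (x N)‖ ≤ 2 * ‖f‖ := by
      refine (norm_sub_le _ _).trans ?_
      linarith [f.norm_coe_le_norm (g^[N + 1] (x N)), f.norm_coe_le_norm (x N)]
    have h6 : ‖((N + 1 : ℕ) : ℝ)⁻¹‖ = 1 / ((N : ℝ) + 1) := by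
      rw [Real.norm_of_nonneg (by positivity)]; push_cast; simp
    rw [h6, mul_comm]
    gcongr
  have h7 := tendsto_nhds_unique h3 (h2.sub h1)
  linarith

lemma birkhoff_bound {K : Type*} (g : K → K) (f : K → ℝ) (lam B : ℝ) (hlam : lam < 0)
    (hB : 0 ≤ B) (hf : ∀ x, f x ≤ B) (N : ℕ)
    (hN : ∀ x, birkhoffSum g f (N + 1) x ≤ lam * ((N : ℝ) + 1)) (n : ℕ) :
    ∀ x, birkhoffSum g f n x ≤ lam * n + ((N : ℝ) + 1) * (B - lam) := by
  induction n using Nat.strong_induction_on with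
  | _ n ih =>
    intro x
    by_cases hn : n < N + 1
    · have h1 : birkhoffSum g f n x ≤ n * B := by
        unfold birkhoffSum
        refine (Finset.sum_le_sum (fun i _ => hf _)).trans ?_
        simp
      have h2 : (n : ℝ) ≤ N + 1 := by exact_mod_cast hn.le
      nlinarith
    · obtain ⟨k, rfl⟩ := Nat.exists_eq_add_of_le (not_lt.mp hn)
      rw [birkhoffSum_add]
      have h1 := ih k (by omega) (g^[N + 1] x)
      have h2 := hN x
      push_cast
      linarith

lemma cocycle_le {K E : Type*} [NormedAddCommGroup E] [NormedSpace ℝ E]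
    (g : K → K) (A : K → (E →L[ℝ] E)) (f : K → ℝ) (hf : ∀ x, ‖A x‖ ≤ Real.exp (f x)) (n : ℕ)
    (x : K) : ‖mapCocycle g A n x‖ ≤ Real.exp (birkhoffSum g f n x) := by
  induction n with
  | zero => simpa [mapCocycle] using ContinuousLinearMap.norm_id_le
  | succ n ih =>
    rw [birkhoffSum_succ, Real.exp_add, mul_comm]
    refine (ContinuousLinearMap.opNorm_comp_le _ _).trans ?_
    exact mul_le_mul (hf _) ih (norm_nonneg _) (Real.exp_pos _).le

/-- If `∫ log ‖A(x)‖ dμ < λ < 0` for every `g`-invariant Borel probability measure `μ` on a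
compact metric space `K`, then the cocycle contracts uniformly exponentially:
`‖A_n(x)‖ ≤ C e^{λ n}`. -/
theorem cocycle_uniform_contraction_of_integral_lt
    {K : Type*} [MetricSpace K] [CompactSpace K] [MeasurableSpace K] [BorelSpace K]
    {E : Type*} [NormedAddCommGroup E] [NormedSpace ℝ E] [Nontrivial E]
    (g : K → K) (hg : Continuous g) (A : K → (E →L[ℝ] E)) (hA : Continuous A)
    (lam : ℝ) (hlam : lam < 0)
    (h : ∀ μ : Measure K, IsProbabilityMeasure μ → μ.map g = μ →
      (∫ x, Real.log ‖A x‖ ∂μ) < lam) :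
    ∃ C : ℝ, 0 < C ∧ ∀ n : ℕ, 1 ≤ n → ∀ x : K,
      ‖mapCocycle g A n x‖ ≤ C * Real.exp (lam * n) := by
  let f : ℕ → K → ℝ := fun M x => Real.log (max ‖A x‖ (Real.exp (-(M : ℝ))))
  have hpos : ∀ M x, 0 < max ‖A x‖ (Real.exp (-(M : ℝ))) := fun M x =>
    lt_max_of_lt_right (Real.exp_pos _)
  have hfc : ∀ M, Continuous (f M) := fun M =>
    (hA.norm.max continuous_const).log (fun x => (hpos M x).ne')
  have hfA : ∀ M x, ‖A x‖ ≤ Real.exp (f M x) := by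
    intro M x
    simp only [f]
    rw [Real.exp_log (hpos M x)]
    exact le_max_left _ _
  have hanti : ∀ M N, M ≤ N → ∀ x, f N x ≤ f M x := by
    intro M N hMN x
    refine Real.log_le_log (hpos N x) (max_le_max le_rfl (Real.exp_le_exp.mpr ?_))
    have : (M : ℝ) ≤ N := by exact_mod_cast hMN
    linarith
  have hflog : ∀ M x, f M x ≤ max (Real.log ‖A x‖) (-(M : ℝ)) := by
    intro M x
    simp only [f]
    rcases le_total ‖A x‖ (Real.exp (-(M : ℝ))) with h1 | h1
    · rw [max_eq_right h1, Real.log_exp]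
      exact le_max_right _ _
    · rw [max_eq_left h1]
      exact le_max_left _ _
  have main : ∃ N : ℕ, ∀ x, birkhoffSum g (f N) (N + 1) x ≤ lam * ((N : ℝ) + 1) := by
    by_contra hcon
    push Not at hcon
    choose x hx using hcon
    obtain ⟨U, μ, hU, hμ, hinv, hlim⟩ := exists_limit g hg x
    have hlt := h μ hμ hinv
    have hint : Integrable (fun x => Real.log ‖A x‖) μ := by
      by_contra hni
      rw [integral_undef hni] at hlt
      linarith
    have hM : ∀ M : ℕ, lam ≤ ∫ y, f M y ∂μ := by
      intro M
      refine ge_of_tendsto (hlim (f M) (hfc M)) ?_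
      filter_upwards [hU (eventually_ge_atTop M)] with N hN
      have h1 : birkhoffSum g (f N) (N + 1) (x N) ≤ birkhoffSum g (f M) (N + 1) (x N) :=
        Finset.sum_le_sum (fun i _ => hanti M N hN _)
      have h2 := (hx N).le.trans h1
      rw [birkhoffAverage, smul_eq_mul, ← div_eq_inv_mul, le_div_iff₀ (by positivity)]
      push_cast
      exact h2
    have hmeas : ∀ M : ℕ, AEStronglyMeasurable
        (fun y => max (Real.log ‖A y‖) (-(M : ℝ))) μ := fun M =>
      hint.aestronglyMeasurable.sup aestronglyMeasurable_const
    have hbd : ∀ (M : ℕ) y, ‖max (Real.log ‖A y‖) (-(M : ℝ))‖ ≤ ‖Real.log ‖A y‖‖ := by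
      intro M y
      have hM0 : (0 : ℝ) ≤ M := Nat.cast_nonneg M
      rw [Real.norm_eq_abs, Real.norm_eq_abs]
      rcases le_total (Real.log ‖A y‖) (-(M : ℝ)) with h1 | h1
      · rw [max_eq_right h1, abs_of_nonpos (by linarith), abs_of_nonpos (by linarith)]
        linarith
      · rw [max_eq_left h1]
    have hdom : Tendsto (fun M : ℕ => ∫ y, max (Real.log ‖A y‖) (-(M : ℝ)) ∂μ) atTop
        (𝓝 (∫ y, Real.log ‖A y‖ ∂μ)) := by
      refine tendsto_integral_of_dominated_convergence (fun y => ‖Real.log ‖A y‖‖) hmeas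
        hint.norm (fun M => ae_of_all _ (hbd M)) (ae_of_all _ fun y => ?_)
      refine tendsto_const_nhds.congr' ?_
      obtain ⟨M0, hM0⟩ := exists_nat_ge (-(Real.log ‖A y‖))
      filter_upwards [eventually_ge_atTop M0] with M hM
      have : (M0 : ℝ) ≤ M := by exact_mod_cast hM
      rw [max_eq_left (by linarith)]
    have hge : lam ≤ ∫ y, Real.log ‖A y‖ ∂μ := by
      refine ge_of_tendsto' hdom fun M => (hM M).trans ?_
      refine integral_mono ?_ (hint.norm.mono' (hmeas M) (ae_of_all _ (hbd M))) (hflog M)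
      exact (hfc M).integrable_of_hasCompactSupport (HasCompactSupport.of_compactSpace _)
    linarith
  obtain ⟨N, hN⟩ := main
  obtain ⟨B, hB⟩ := (isCompact_range (hfc N)).bddAbove
  have hB' : ∀ x, f N x ≤ max B 0 := fun x => (hB ⟨x, rfl⟩).trans (le_max_left _ _)
  refine ⟨Real.exp (((N : ℝ) + 1) * (max B 0 - lam)), Real.exp_pos _, fun n _ x => ?_⟩
  refine (cocycle_le g A (f N) (hfA N) n x).trans ?_
  rw [← Real.exp_add, Real.exp_le_exp]
  linarith [birkhoff_bound g (f N) lam (max B 0) hlam (le_max_right _ _) hB' N hN n x]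
end

section
/- Let K be a compact metric space, g : K → K a continuous map, E a nontrivial normed real vector space, and A : K → (E ≃L E) a map assigning to each x ∈ K a continuous linear isomorphism of E, with x ↦ A(x) and x ↦ A(x)⁻¹ continuous in the operator norm. Write A_n(x) := A(g^{n-1}(x)) ∘ ⋯ ∘ A(x). For a periodic point p of period t (g^t(p) = p, t ≥ 1), let μ_p := (1/t) · ∑_{j=0}^{t-1} δ_{g^j(p)}. Fix λ < 0 and let S be the set of measures μ_p over periodic points p whose period t = t(p) satisfies ∑_{j=0}^{t-1} log ‖(A(g^j(p)))⁻¹‖ ≤ λ · t. Suppose every g-invariant Borel probability measure on K lies in the closure, in the topology of weak convergence, of the convex hull of S. Then for every λ' with λ < λ' < 0 there is a constant C > 0 such that ‖(A_n(x))⁻¹‖ ≤ C · e^{λ' n} for all n ≥ 1 and all x ∈ K. -/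
open MeasureTheory Filter
open scoped ENNReal NNReal

lemma aux_integral_emp {K : Type*} [MetricSpace K] [MeasurableSpace K] [BorelSpace K]
    (g : K → K) (p : K) (t : ℕ) (ψ : K → ℝ) (hψ : Continuous ψ) :
    ∫ y, ψ y ∂((t : ℝ≥0∞)⁻¹ • ∑ j ∈ Finset.range t, Measure.dirac (g^[j] p)) =
      (t : ℝ)⁻¹ * ∑ j ∈ Finset.range t, ψ (g^[j] p) := by
  rw [integral_smul_measure, integral_finsetSum_measure]
  · simp [integral_dirac]
  · intro i _
    exact integrable_dirac (by simp)

lemma aux_int {K : Type*} [MetricSpace K] [CompactSpace K] [MeasurableSpace K] [BorelSpace K]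
    (μ : Measure K) [IsFiniteMeasure μ] (ψ : K → ℝ) (hψ : Continuous ψ) : Integrable ψ μ :=
  (BoundedContinuousFunction.mkOfCompact ⟨ψ, hψ⟩).integrable μ

lemma aux_cont {K : Type*} [MetricSpace K] [CompactSpace K] [MeasurableSpace K] [BorelSpace K]
    (ψ : K → ℝ) (hψ : Continuous ψ) :
    Continuous fun μ : ProbabilityMeasure K => ∫ y, ψ y ∂(μ : Measure K) :=
  ProbabilityMeasure.continuous_integral_boundedContinuousFunction
    (BoundedContinuousFunction.mkOfCompact ⟨ψ, hψ⟩)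

/-- Uniform upper bound on Birkhoff sums from invariant measures. -/
lemma aux_birkhoff {K : Type*} [MetricSpace K] [CompactSpace K] [MeasurableSpace K] [BorelSpace K]
    (g : K → K) (hg : Continuous g) (φ : K → ℝ) (hφ : Continuous φ) (a b : ℝ) (hab : a < b)
    (h : ∀ μ : ProbabilityMeasure K, (μ : Measure K).map g = (μ : Measure K) →
      ∫ y, φ y ∂(μ : Measure K) ≤ a) :
    ∃ N : ℕ, 1 ≤ N ∧ ∀ x, ∑ j ∈ Finset.range N, φ (g^[j] x) ≤ b * N := by
  by_contra! hcon
  have hcon' : ∀ n : ℕ, ∃ x, b * ((n + 1 : ℕ) : ℝ) < ∑ j ∈ Finset.range (n + 1), φ (g^[j] x) :=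
    fun n => hcon (n + 1) (by omega)
  choose x hx using hcon'
  have hprob : ∀ n : ℕ, IsProbabilityMeasure (((n + 1 : ℕ) : ℝ≥0∞)⁻¹ •
      ∑ j ∈ Finset.range (n + 1), Measure.dirac (g^[j] (x n))) := by
    intro n
    constructor
    simp only [Measure.smul_apply, Measure.finsetSum_apply, measure_univ, Finset.sum_const,
      Finset.card_range, smul_eq_mul, nsmul_eq_mul, mul_one]
    exact ENNReal.inv_mul_cancel (by simp) (ENNReal.natCast_ne_top _)
  let m : ℕ → ProbabilityMeasure K := fun n => ⟨_, hprob n⟩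
  have hm : ∀ (ψ : K → ℝ), Continuous ψ → ∀ n, ∫ y, ψ y ∂(m n : Measure K) =
      ((n + 1 : ℕ) : ℝ)⁻¹ * ∑ j ∈ Finset.range (n + 1), ψ (g^[j] (x n)) :=
    fun ψ hψ n => aux_integral_emp g (x n) (n + 1) ψ hψ
  let U : Ultrafilter ℕ := hyperfilter ℕ
  have hU : (U : Filter ℕ) ≤ atTop := Nat.hyperfilter_le_atTop
  obtain ⟨μ, -, hμ⟩ := isCompact_univ.ultrafilter_le_nhds (U.map m) (by simp)
  have hμ' : Tendsto m U (nhds μ) := hμ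
  have hlim : ∀ ψ : K → ℝ, Continuous ψ →
      Tendsto (fun n => ∫ y, ψ y ∂(m n : Measure K)) U (nhds (∫ y, ψ y ∂(μ : Measure K))) :=
    fun ψ hψ => ((aux_cont ψ hψ).tendsto μ).comp hμ'
  have hinv : (μ : Measure K).map g = (μ : Measure K) := by
    have := Measure.isProbabilityMeasure_map (μ := (μ : Measure K)) hg.measurable.aemeasurable
    apply ext_of_forall_integral_eq_of_IsFiniteMeasure
    intro f
    rw [integral_map hg.measurable.aemeasurable f.continuous.aestronglyMeasurable]
    have h1 := (hlim (fun y => f (g y)) (f.continuous.comp hg)).sub (hlim f f.continuous)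
    have h2 : Tendsto (fun n => ∫ y, f (g y) ∂(m n : Measure K) - ∫ y, f y ∂(m n : Measure K))
        U (nhds 0) := by
      have h3 : Tendsto (fun n : ℕ => (2 * ‖f‖) * (1 / ((n : ℝ) + 1))) U (nhds 0) := by
        have := (tendsto_one_div_add_atTop_nhds_zero_nat (𝕜 := ℝ)).const_mul (2 * ‖f‖)
        rw [mul_zero] at this
        exact this.mono_left hU
      refine squeeze_zero_norm (fun n => ?_) h3
      rw [hm (fun y => f (g y)) (f.continuous.comp hg), hm _ f.continuous, ← mul_sub, ← Finset.sum_sub_distrib]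
      have h4 : ∑ j ∈ Finset.range (n + 1), (f (g (g^[j] (x n))) - f (g^[j] (x n))) =
          f (g^[n + 1] (x n)) - f (x n) := by
        have := Finset.sum_range_sub (fun j => f (g^[j] (x n))) (n + 1)
        simpa [Function.iterate_succ_apply'] using this
      rw [h4, norm_mul, mul_comm]
      have h5 : ‖f (g^[n + 1] (x n)) - f (x n)‖ ≤ 2 * ‖f‖ := by
        have := norm_sub_le (f (g^[n + 1] (x n))) (f (x n))
        have := f.norm_coe_le_norm (g^[n + 1] (x n))
        have := f.norm_coe_le_norm (x n)
        linarith
      have h6 : ‖((n + 1 : ℕ) : ℝ)⁻¹‖ = 1 / ((n : ℝ) + 1) := by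
        rw [Real.norm_of_nonneg (by positivity)]
        push_cast
        rw [one_div]
      rw [h6]
      exact mul_le_mul_of_nonneg_right h5 (by positivity)
    have := tendsto_nhds_unique h1 h2
    linarith
  have hge : b ≤ ∫ y, φ y ∂(μ : Measure K) := by
    refine ge_of_tendsto (hlim φ hφ) (Eventually.of_forall fun n => ?_)
    rw [hm φ hφ]
    have hpos : (0 : ℝ) < ((n + 1 : ℕ) : ℝ) := by positivity
    rw [inv_mul_eq_div, le_div_iff₀ hpos]
    exact (hx n).le
  linarith [h μ hinv]

lemma aux_sum_bound {K : Type*} (g : K → K) (φ : K → ℝ) (b M : ℝ) (hb : b < 0) (hM : 0 ≤ M)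
    (hφ : ∀ x, φ x ≤ M) (N : ℕ) (hN : 1 ≤ N)
    (h : ∀ x, ∑ j ∈ Finset.range N, φ (g^[j] x) ≤ b * N) :
    ∀ n x, ∑ j ∈ Finset.range n, φ (g^[j] x) ≤ N * (M - b) + b * n := by
  intro n
  induction n using Nat.strong_induction_on with
  | _ n ih =>
    intro x
    by_cases hn : n < N
    · have h1 : ∑ j ∈ Finset.range n, φ (g^[j] x) ≤ n * M := by
        have := Finset.sum_le_card_nsmul (Finset.range n) (fun j => φ (g^[j] x)) M
          (fun j _ => hφ _)
        simpa using this
      have h2 : (n : ℝ) ≤ N := by exact_mod_cast hn.le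
      nlinarith
    · obtain ⟨k, rfl⟩ := Nat.exists_eq_add_of_le (not_lt.1 hn)
      rw [Finset.sum_range_add]
      have h1 := ih k (by omega) (g^[N] x)
      have h2 := h x
      have h3 : ∑ j ∈ Finset.range k, φ (g^[N + j] x) =
          ∑ j ∈ Finset.range k, φ (g^[j] (g^[N] x)) := by
        refine Finset.sum_congr rfl fun j _ => ?_
        rw [← Function.iterate_add_apply, add_comm]
      rw [h3]
      push_cast
      linarith

lemma aux_norm_pos {E : Type*} [NormedAddCommGroup E] [NormedSpace ℝ E] [Nontrivial E]
    (B : E ≃L[ℝ] E) : 0 < ‖(B.symm : E →L[ℝ] E)‖ := by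
  rw [norm_pos_iff]
  intro h0
  obtain ⟨v, hv⟩ := exists_ne (0 : E)
  have h1 : (B.symm : E →L[ℝ] E) v = 0 := by rw [h0]; rfl
  exact hv (by simpa using h1)

lemma aux_cocycle {K E : Type*} [NormedAddCommGroup E] [NormedSpace ℝ E] [Nontrivial E]
    (g : K → K) (A : K → (E ≃L[ℝ] E)) (n : ℕ) (x : K) :
    ‖((equivCocycle g A n x).symm : E →L[ℝ] E)‖ ≤
      Real.exp (∑ j ∈ Finset.range n, Real.log ‖((A (g^[j] x)).symm : E →L[ℝ] E)‖) := by
  induction n with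
  | zero =>
    simp only [Finset.range_zero, Finset.sum_empty, Real.exp_zero]
    exact ContinuousLinearMap.norm_id_le
  | succ n ih =>
    rw [Finset.sum_range_succ, Real.exp_add, Real.exp_log (aux_norm_pos _)]
    have : ((equivCocycle g A (n + 1) x).symm : E →L[ℝ] E) =
      ((equivCocycle g A n x).symm : E →L[ℝ] E).comp ((A (g^[n] x)).symm : E →L[ℝ] E) := rfl
    rw [this]
    exact (ContinuousLinearMap.opNorm_comp_le _ _).trans
      (mul_le_mul_of_nonneg_right ih (norm_nonneg _))

/-- If every `g`-invariant Borel probability measure lies in the weak closure of the convex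
hull of the set `S` of uniform measures on periodic orbits along which
`∑_{j<t} log ‖(A(g^j(p)))⁻¹‖ ≤ λ t` (with `λ < 0`), then for every `λ < λ' < 0` the inverse
cocycle satisfies `‖(A_n(x))⁻¹‖ ≤ C e^{λ' n}` uniformly on `K`. -/
theorem cocycle_expansion_of_periodic_measures
    {K : Type*} [MetricSpace K] [CompactSpace K] [MeasurableSpace K] [BorelSpace K]
    {E : Type*} [NormedAddCommGroup E] [NormedSpace ℝ E] [Nontrivial E]
    (g : K → K) (hg : Continuous g) (A : K → (E ≃L[ℝ] E))
    (hA : Continuous fun x => (A x : E →L[ℝ] E))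
    (hA' : Continuous fun x => ((A x).symm : E →L[ℝ] E))
    (lam : ℝ) (hlam : lam < 0)
    (S : Set (ProbabilityMeasure K))
    (hS : S = {ν : ProbabilityMeasure K | ∃ (p : K) (t : ℕ), 1 ≤ t ∧ g^[t] p = p ∧
      (∑ j ∈ Finset.range t, Real.log ‖((A (g^[j] p)).symm : E →L[ℝ] E)‖) ≤ lam * t ∧
      (ν : Measure K) = (t : ℝ≥0∞)⁻¹ • ∑ j ∈ Finset.range t, Measure.dirac (g^[j] p)})
    (hdense : ∀ μ : ProbabilityMeasure K, (μ : Measure K).map g = (μ : Measure K) →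
      μ ∈ closure {m : ProbabilityMeasure K |
        ∃ (r : ℕ) (w : Fin r → ℝ≥0) (ν : Fin r → ProbabilityMeasure K),
          (∑ i, w i) = 1 ∧ (∀ i, ν i ∈ S) ∧
          (m : Measure K) = ∑ i, (w i : ℝ≥0∞) • (ν i : Measure K)}) :
    ∀ lam' : ℝ, lam < lam' → lam' < 0 →
      ∃ C : ℝ, 0 < C ∧ ∀ n : ℕ, 1 ≤ n → ∀ x : K,
        ‖((equivCocycle g A n x).symm : E →L[ℝ] E)‖ ≤ C * Real.exp (lam' * n) := by
  intro lam' h1 h2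
  set φ : K → ℝ := fun x => Real.log ‖((A x).symm : E →L[ℝ] E)‖ with hφdef
  have hφ : Continuous φ := hA'.norm.log fun x => (aux_norm_pos (A x)).ne'
  have hSle : ∀ ν ∈ S, ∫ y, φ y ∂(ν : Measure K) ≤ lam := by
    intro ν hν
    rw [hS] at hν
    obtain ⟨p, t, ht, -, hsum, hν⟩ := hν
    rw [hν, aux_integral_emp g p t φ hφ, inv_mul_eq_div,
      div_le_iff₀ (by exact_mod_cast ht)]
    exact hsum
  have hinv : ∀ μ : ProbabilityMeasure K, (μ : Measure K).map g = (μ : Measure K) →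
      ∫ y, φ y ∂(μ : Measure K) ≤ lam := by
    intro μ hμ
    have hcl : IsClosed {m : ProbabilityMeasure K | ∫ y, φ y ∂(m : Measure K) ≤ lam} :=
      isClosed_le (aux_cont φ hφ) continuous_const
    refine closure_minimal ?_ hcl (hdense μ hμ)
    rintro m ⟨r, w, ν, hw, hν, hm⟩
    simp only [Set.mem_setOf_eq]
    rw [hm, integral_finsetSum_measure
      (fun i _ => (aux_int _ φ hφ).smul_measure ENNReal.coe_ne_top)]
    have hw' : ∑ i, (w i : ℝ) = 1 := by exact_mod_cast hw
    calc ∑ i, ∫ y, φ y ∂((w i : ℝ≥0∞) • (ν i : Measure K))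
        ≤ ∑ i, (w i : ℝ) * lam := by
          refine Finset.sum_le_sum fun i _ => ?_
          rw [integral_smul_measure]
          simp only [ENNReal.coe_toReal, smul_eq_mul]
          exact mul_le_mul_of_nonneg_left (hSle _ (hν i)) (w i).2
      _ = lam := by rw [← Finset.sum_mul, hw', one_mul]
  obtain ⟨N, hN, hNb⟩ := aux_birkhoff g hg φ hφ lam lam' h1 hinv
  obtain ⟨M, hM⟩ := isCompact_univ.bddAbove_image (f := φ) hφ.continuousOn
  have hM' : ∀ x, φ x ≤ max M 0 := fun x =>
    (hM (Set.mem_image_of_mem φ (Set.mem_univ x))).trans (le_max_left _ _)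
  refine ⟨Real.exp (N * (max M 0 - lam')), Real.exp_pos _, fun n _ x => ?_⟩
  rw [← Real.exp_add]
  exact (aux_cocycle g A n x).trans (Real.exp_le_exp.2
    (aux_sum_bound g φ lam' (max M 0) h2 (le_max_right _ _) hM' N hN hNb n x))
end

section
/- Let K be a compact metric space, g : K → K a continuous map, and (φ_n)_{n≥1} a sequence of continuous functions φ_n : K → ℝ that is g-subadditive, i.e. φ_{n₁+n₂}(x) ≤ φ_{n₁}(x) + φ_{n₂}(g^{n₁}(x)) for all n₁, n₂ ≥ 1 and all x ∈ K. Suppose that ∫ φ_1 dμ < λ for every g-invariant Borel probability measure μ on K, where λ < 0. Then there is a constant C > 0 such that φ_n(x) ≤ C + n · λ for all n ≥ 1 and all x ∈ K. -/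
open MeasureTheory Filter

theorem aux_empirical {K : Type*} [MetricSpace K] [CompactSpace K] [MeasurableSpace K]
    [BorelSpace K] (g : K → K) (n : ℕ) (hn : 1 ≤ n) (x : K) :
    ∃ ν : ProbabilityMeasure K, ∀ f : K → ℝ, Continuous f →
      ∫ y, f y ∂(ν : Measure K) = (n : ℝ)⁻¹ * ∑ k ∈ Finset.range n, f (g^[k] x) := by
  refine ⟨⟨(n : ENNReal)⁻¹ • ∑ k ∈ Finset.range n, Measure.dirac (g^[k] x), ⟨?_⟩⟩, ?_⟩
  · simp only [Measure.smul_apply, Measure.finsetSum_apply, measure_univ, Finset.sum_const,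
      Finset.card_range, nsmul_eq_mul, smul_eq_mul, mul_one]
    exact ENNReal.inv_mul_cancel (by simpa using by lia) (by simp)
  · intro f hf
    have : ∀ k ∈ Finset.range n, Integrable f (Measure.dirac (g^[k] x)) := fun k _ =>
      (integrable_dirac (by simp))
    simp only [ProbabilityMeasure.coe_mk, integral_smul_measure]
    rw [integral_finsetSum_measure this]
    simp

theorem aux_key {K : Type*} [MetricSpace K] [CompactSpace K] [MeasurableSpace K] [BorelSpace K]
    (g : K → K) (hg : Continuous g) (f : K → ℝ) (hf : Continuous f) (lam : ℝ)
    (h : ∀ μ : Measure K, IsProbabilityMeasure μ → μ.map g = μ → (∫ x, f x ∂μ) < lam) :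
    ∃ N : ℕ, ∀ n, N ≤ n → ∀ x, ∑ k ∈ Finset.range n, f (g^[k] x) ≤ n * lam := by
  by_contra! hc
  choose n hn x hx using fun N => hc (N + 1)
  choose ν hν using fun N => aux_empirical g (n N) (by have := hn N; lia) (x N)
  let U := hyperfilter ℕ
  obtain ⟨μ, hμ⟩ : ∃ μ, Tendsto ν U (nhds μ) := ⟨(U.map ν).lim, (U.map ν).le_nhds_lim⟩
  rw [ProbabilityMeasure.tendsto_iff_forall_integral_tendsto] at hμ
  have hlim : ∀ F : K → ℝ, Continuous F →
      Tendsto (fun N => ∫ y, F y ∂(ν N : Measure K)) U (nhds (∫ y, F y ∂(μ : Measure K))) :=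
    fun F hF => hμ (BoundedContinuousFunction.mkOfCompact ⟨F, hF⟩)
  have hntop : Tendsto n U atTop :=
    (tendsto_atTop_mono (fun N => (Nat.le_succ N).trans (hn N)) tendsto_id).mono_left Nat.hyperfilter_le_atTop
  have hinv : (μ : Measure K).map g = μ := by
    have : IsProbabilityMeasure ((μ : Measure K).map g) :=
      Measure.isProbabilityMeasure_map hg.aemeasurable
    apply ext_of_forall_integral_eq_of_IsFiniteMeasure
    intro F
    rw [integral_map hg.aemeasurable F.continuous.aestronglyMeasurable]
    have h1 := (hlim (fun y => F (g y)) (F.continuous.comp hg)).sub (hlim F F.continuous)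
    have h2 : Tendsto (fun N => (n N : ℝ)⁻¹ * (2 * ‖F‖)) U (nhds 0) := by
      simpa using ((tendsto_inv_atTop_zero.comp
        (tendsto_natCast_atTop_atTop.comp hntop)).mul_const (2 * ‖F‖))
    refine sub_eq_zero.1 (tendsto_nhds_unique h1 (squeeze_zero_norm (fun N => ?_) h2))
    rw [hν N (fun y => F (g y)) (F.continuous.comp hg), hν N _ F.continuous, ← mul_sub, ← Finset.sum_sub_distrib]
    simp only [← Function.iterate_succ_apply' g]
    rw [Finset.sum_range_sub (fun k => F (g^[k] (x N))), norm_mul, norm_inv, Real.norm_natCast]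
    gcongr
    refine (norm_sub_le _ _).trans ?_
    linarith [F.norm_coe_le_norm (g^[n N] (x N)), F.norm_coe_le_norm (g^[0] (x N))]
  refine absurd (h μ inferInstance hinv) (not_lt.2 (ge_of_tendsto (hlim f hf) ?_))
  refine Eventually.of_forall fun N => ?_
  have hpos : (0 : ℝ) < n N := by have := hn N; exact_mod_cast (by lia : 0 < n N)
  rw [hν N f hf, inv_mul_eq_div, le_div_iff₀ hpos, mul_comm]
  exact (hx N).le

/-- If `(φ_n)` is a `g`-subadditive sequence of continuous functions on a compact metric space
and `∫ φ₁ dμ < λ < 0` for every `g`-invariant Borel probability measure `μ`, then there is a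
constant `C > 0` with `φ_n(x) ≤ C + n λ` for all `n ≥ 1` and all `x`. -/
theorem subadditive_le_const_add_of_integral_lt
    {K : Type*} [MetricSpace K] [CompactSpace K] [MeasurableSpace K] [BorelSpace K]
    (g : K → K) (hg : Continuous g) (φ : ℕ → K → ℝ)
    (hφcont : ∀ n, 1 ≤ n → Continuous (φ n))
    (hsub : ∀ n₁, 1 ≤ n₁ → ∀ n₂, 1 ≤ n₂ → ∀ x : K,
      φ (n₁ + n₂) x ≤ φ n₁ x + φ n₂ (g^[n₁] x))
    (lam : ℝ) (hlam : lam < 0)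
    (h : ∀ μ : Measure K, IsProbabilityMeasure μ → μ.map g = μ → (∫ x, φ 1 x ∂μ) < lam) :
    ∃ C : ℝ, 0 < C ∧ ∀ n : ℕ, 1 ≤ n → ∀ x : K, φ n x ≤ C + (n : ℝ) * lam := by
  have hf := hφcont 1 le_rfl
  obtain ⟨N, hN⟩ := aux_key g hg (φ 1) hf lam h
  have hle : ∀ n, 1 ≤ n → ∀ x, φ n x ≤ ∑ k ∈ Finset.range n, φ 1 (g^[k] x) := by
    intro n hn
    induction n, hn using Nat.le_induction with
    | base => intro x; simp
    | succ n hn ih =>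
      intro x
      rw [Finset.sum_range_succ]
      linarith [hsub n hn 1 le_rfl x, ih x]
  let F := BoundedContinuousFunction.mkOfCompact (⟨φ 1, hf⟩ : C(K, ℝ))
  have hF : ∀ y, φ 1 y ≤ ‖F‖ := fun y => (le_abs_self _).trans (F.norm_coe_le_norm y)
  have hF0 : 0 ≤ ‖F‖ := norm_nonneg _
  have hN0 : (0 : ℝ) ≤ N := Nat.cast_nonneg N
  refine ⟨N * (‖F‖ - lam) + 1, by nlinarith [mul_nonneg hN0 hF0], fun n hn x => ?_⟩
  refine (hle n hn x).trans ?_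
  rcases le_total N n with hNn | hNn
  · nlinarith [hN n hNn x, mul_nonneg hN0 hF0]
  · have h1 : ∑ k ∈ Finset.range n, φ 1 (g^[k] x) ≤ n * ‖F‖ := by
      simpa using Finset.sum_le_card_nsmul (Finset.range n) _ _ (fun k _ => hF (g^[k] x))
    have h2 : (n : ℝ) ≤ N := by exact_mod_cast hNn
    nlinarith
end
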